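/- Suppose ρ∘J(v) = J(v)∘ρ for every v ∈ V. Let λ₁, λ₂, λ₃, λ₄ be real numbers and let xᵢ lie in the generalized eigenspace of ρ for λᵢ (i = 1,2,3,4). If A(x₁,x₂,x₃,x₄) ≠ 0, then λ₁ = λ₂ = λ₃ = λ₄. (This is the core of Theorem 1.3: a Puffini–Videv 0-model of arbitrary signature decomposes along the generalized eigenspaces of its Ricci operator into pseudo-Einstein summands.) -/

import Mathlib

/-- Generalized eigenspaces of `ρ` for distinct eigenvalues are orthogonal with respect to every
bilinear form for which `ρ` is self-adjoint. -/
theorem LinearMap.apply_eq_zero_of_mem_ker_pow_of_ne {V : Type*} [AddCommGroup V] [Module ℝ V]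
    (b : V →ₗ[ℝ] V →ₗ[ℝ] ℝ) (ρ : V →ₗ[ℝ] V) (hb : ∀ x y, b (ρ x) y = b x (ρ y))
    {l μ : ℝ} (hne : l ≠ μ) (n : ℕ) {x y : V}
    (hx : x ∈ LinearMap.ker ((ρ - l • LinearMap.id) ^ n))
    (hy : y ∈ LinearMap.ker ((ρ - μ • LinearMap.id) ^ n)) : b x y = 0 := by
  have hpow : ∀ (k : ℕ) (x y : V), b (((ρ - l • LinearMap.id) ^ k : Module.End ℝ V) x) y =
      b x (((ρ - l • LinearMap.id) ^ k : Module.End ℝ V) y) := by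
    intro k
    induction k with
    | zero => intro x y; simp
    | succ k ih =>
      intro x y
      rw [pow_succ, Module.End.mul_apply, ih, ← pow_succ, pow_succ', Module.End.mul_apply]
      simp [hb]
  have hcop : IsCoprime ((Polynomial.X - Polynomial.C l) ^ n)
      ((Polynomial.X - Polynomial.C μ) ^ n) :=
    (Polynomial.isCoprime_X_sub_C_of_isUnit_sub (sub_ne_zero.2 hne).isUnit).pow
  obtain ⟨p, q, hpq⟩ := hcop
  have haeval : ∀ c : ℝ, Polynomial.aeval ρ ((Polynomial.X - Polynomial.C c) ^ n) =
      (ρ - c • LinearMap.id) ^ n := by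
    intro c
    simp [Algebra.algebraMap_eq_smul_one, Module.End.one_eq_id]
  rw [mul_comm p] at hpq
  have h := congrArg (fun r => Polynomial.aeval ρ r y) hpq
  simp only [map_add, map_mul, haeval, LinearMap.add_apply, Module.End.mul_apply,
    LinearMap.mem_ker.1 hy, map_zero, add_zero, map_one, Module.End.one_apply] at h
  rw [← h, ← hpow, LinearMap.mem_ker.1 hx, map_zero, LinearMap.zero_apply]

/-- core of Theorem 1.3: if ρ commutes with every Jacobi operator and
xᵢ lies in the generalized eigenspace of ρ for λᵢ, then A(x₁,x₂,x₃,x₄) ≠ 0 implies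
λ₁ = λ₂ = λ₃ = λ₄. -/
theorem stmt_19 {V : Type*} [AddCommGroup V] [Module ℝ V] [FiniteDimensional ℝ V]
    (B : V →ₗ[ℝ] V →ₗ[ℝ] ℝ)
    (hBsymm : ∀ x y : V, B x y = B y x)
    (hBnd : ∀ x : V, (∀ y : V, B x y = 0) → x = 0)
    (A : V →ₗ[ℝ] V →ₗ[ℝ] V →ₗ[ℝ] V →ₗ[ℝ] ℝ)
    (hA1 : ∀ v₁ v₂ v₃ v₄ : V, A v₁ v₂ v₃ v₄ = A v₃ v₄ v₁ v₂)
    (hA2 : ∀ v₁ v₂ v₃ v₄ : V, A v₁ v₂ v₃ v₄ = - A v₂ v₁ v₃ v₄)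
    (hA3 : ∀ v₁ v₂ v₃ v₄ : V, A v₁ v₂ v₃ v₄ + A v₂ v₃ v₁ v₄ + A v₃ v₁ v₂ v₄ = 0)
    (J : V → V →ₗ[ℝ] V)
    (hJ : ∀ v x y : V, B (J v x) y = A x v v y)
    (m : ℕ) (hm : m = Module.finrank ℝ V)
    (u : Fin m → V) (ζ : Fin m → ℝ) (hζ : ∀ i, ζ i = 1 ∨ ζ i = -1)
    (hu_span : Submodule.span ℝ (Set.range u) = ⊤)
    (hu : ∀ i j, B (u i) (u j) = if i = j then ζ i else 0)
    (ρ : V →ₗ[ℝ] V) (hρ : ρ = ∑ i, ζ i • J (u i))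
    (hcomm : ∀ v : V, ρ ∘ₗ J v = J v ∘ₗ ρ)
    (μ₁ μ₂ μ₃ μ₄ : ℝ) (x₁ x₂ x₃ x₄ : V)
    (hx₁ : x₁ ∈ LinearMap.ker ((ρ - μ₁ • LinearMap.id) ^ Module.finrank ℝ V))
    (hx₂ : x₂ ∈ LinearMap.ker ((ρ - μ₂ • LinearMap.id) ^ Module.finrank ℝ V))
    (hx₃ : x₃ ∈ LinearMap.ker ((ρ - μ₃ • LinearMap.id) ^ Module.finrank ℝ V))
    (hx₄ : x₄ ∈ LinearMap.ker ((ρ - μ₄ • LinearMap.id) ^ Module.finrank ℝ V))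
    (hA0 : A x₁ x₂ x₃ x₄ ≠ 0) :
    μ₁ = μ₂ ∧ μ₂ = μ₃ ∧ μ₃ = μ₄ := by
  have hself : ∀ x y : V, B (ρ x) y = B x (ρ y) := by
    intro x y
    rw [hρ]
    simp only [LinearMap.sum_apply, LinearMap.smul_apply, map_sum, map_smul]
    refine Finset.sum_congr rfl fun i _ => ?_
    rw [hBsymm x, hJ, hJ, hA1, hA2, hA1, hA2, neg_neg, hA1]
  have hquad : ∀ v x y : V, A (ρ x) v v y = A x v v (ρ y) := by
    intro v x y
    rw [← hJ, ← hJ, ← hself]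
    exact congrArg (fun f => B f y) (LinearMap.congr_fun (hcomm v) x).symm
  have hpol : ∀ v w x y : V, A (ρ x) v w y + A (ρ x) w v y = A x v w (ρ y) + A x w v (ρ y) := by
    intro v w x y
    have h := hquad (v + w) x y
    simp only [map_add, LinearMap.add_apply] at h
    linarith [hquad v x y, hquad w x y]
  have horth : ∀ {l μ : ℝ}, l ≠ μ → ∀ {x y : V},
      x ∈ LinearMap.ker ((ρ - l • LinearMap.id) ^ Module.finrank ℝ V) →
      y ∈ LinearMap.ker ((ρ - μ • LinearMap.id) ^ Module.finrank ℝ V) →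
      ∀ v w : V, A x v w y + A x w v y = 0 := by
    intro l μ hne x y hx hy v w
    exact LinearMap.apply_eq_zero_of_mem_ker_pow_of_ne
      ((A.flip v).flip w + (A.flip w).flip v) ρ (fun x y => hpol v w x y) hne _ hx hy
  have hanti : ∀ a b c d : V, A a b c d = - A a b d c := by
    intro a b c d
    rw [hA1, hA2, hA1 d c]
  have hpair : ∀ a b c d : V, A a b c d = A b a d c := by
    intro a b c d
    rw [hA2, hanti, neg_neg]
  have hbianchi : A x₁ x₂ x₃ x₄ + A x₁ x₃ x₄ x₂ + A x₁ x₄ x₂ x₃ = 0 := by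
    linarith [hA3 x₂ x₃ x₄ x₁, hA1 x₁ x₂ x₃ x₄, hA1 x₁ x₃ x₄ x₂, hA1 x₁ x₄ x₂ x₃,
      hanti x₃ x₄ x₁ x₂, hanti x₄ x₂ x₁ x₃, hanti x₂ x₃ x₁ x₄]
  have h1324 := hanti x₁ x₃ x₂ x₄
  have h1432 := hanti x₁ x₄ x₃ x₂
  have h1243 := hanti x₁ x₂ x₄ x₃
  have h14 : μ₁ ≠ μ₄ → A x₁ x₂ x₃ x₄ = A x₁ x₃ x₄ x₂ := fun h => by
    linarith [horth h hx₁ hx₄ x₂ x₃]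
  have h23 : μ₂ ≠ μ₃ → A x₁ x₂ x₃ x₄ = A x₁ x₃ x₄ x₂ := fun h => by
    linarith [horth h hx₂ hx₃ x₁ x₄, hpair x₁ x₂ x₃ x₄, hA1 x₂ x₄ x₁ x₃]
  have h12 : μ₁ ≠ μ₂ → A x₁ x₃ x₄ x₂ = A x₁ x₄ x₂ x₃ := fun h => by
    linarith [horth h hx₁ hx₂ x₃ x₄]
  have h34 : μ₃ ≠ μ₄ → A x₁ x₃ x₄ x₂ = A x₁ x₄ x₂ x₃ := fun h => by
    linarith [horth h hx₃ hx₄ x₁ x₂, hpair x₁ x₃ x₄ x₂, hA1 x₃ x₂ x₁ x₄]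
  have h13 : μ₁ ≠ μ₃ → A x₁ x₂ x₃ x₄ = A x₁ x₄ x₂ x₃ := fun h => by
    linarith [horth h hx₁ hx₃ x₂ x₄]
  have h24 : μ₂ ≠ μ₄ → A x₁ x₂ x₃ x₄ = A x₁ x₄ x₂ x₃ := fun h => by
    linarith [horth h hx₂ hx₄ x₁ x₃, hpair x₁ x₂ x₄ x₃, hA1 x₂ x₃ x₁ x₄]
  grind
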